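/- arXiv:2006.02611 — 3 statements merged into one kernel-verified Lean document; each statement's English description precedes it below -/
import Mathlib

section
/- Let d, d', r be positive integers with r ≤ min(d, d') and let ε > 0. Then there exist matrices U₁, …, U_N ∈ ℝ^{d×r} and V₁, …, V_{N'} ∈ ℝ^{d'×r} with N ≤ (1 + 4/ε)^{dr} and N' ≤ (1 + 4/ε)^{d'r}, satisfying ‖U_j‖_S ≤ 1 and ‖V_{j'}‖_S ≤ 1 for all j, j', such that for every M ∈ ℝ^{d×d'} with ‖M‖_S ≤ 1 and rank(M) ≤ r there exist indices j, j' with ‖M − U_j V_{j'}ᵀ‖_S ≤ ε. -/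
open Matrix

/-- Spectral norm (largest singular value) of a real matrix, as the operator norm of the
associated linear map between Euclidean spaces. -/
noncomputable def specNorm {m n : Type*} [Fintype m] [Fintype n] [DecidableEq n]
    (A : Matrix m n ℝ) : ℝ :=
  ‖LinearMap.toContinuousLinearMap (Matrix.toEuclideanLin A)‖

open Module

section
variable {E : Type*} [NormedAddCommGroup E] [NormedSpace ℝ E] [FiniteDimensional ℝ E]

open MeasureTheory Metric ENNReal in
/-- Volume bound for `δ`-separated subsets of the unit ball. -/
theorem card_le_of_separated_unitBall {δ : ℝ} (hδ : 0 < δ) (s : Finset E)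
    (hs : ∀ c ∈ s, ‖c‖ ≤ 1) (h : ∀ c ∈ s, ∀ d ∈ s, c ≠ d → δ ≤ ‖c - d‖) :
    (s.card : ℝ) ≤ (1 + 2 / δ) ^ finrank ℝ E := by
  borelize E
  let μ : Measure E := Measure.addHaar
  have hδ2 : 0 < δ / 2 := by positivity
  have hρ : 0 < 1 + δ / 2 := by positivity
  have disj : Set.Pairwise (s : Set E) (Function.onFun Disjoint fun c => ball c (δ / 2)) := by
    intro c hc d hd hcd
    apply ball_disjoint_ball
    rw [dist_eq_norm, add_halves]
    exact h c hc d hd hcd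
  have hsub : (⋃ c ∈ s, ball c (δ / 2)) ⊆ ball (0 : E) (1 + δ / 2) := by
    refine Set.iUnion₂_subset fun x hx => ball_subset_ball' ?_
    rw [dist_zero_right]
    linarith [hs x hx]
  have hvol : (s.card : ℝ≥0∞) * ENNReal.ofReal ((δ / 2) ^ finrank ℝ E) * μ (ball 0 1) ≤
      ENNReal.ofReal ((1 + δ / 2) ^ finrank ℝ E) * μ (ball 0 1) :=
    calc
      _ = μ (⋃ c ∈ s, ball c (δ / 2)) := by
        rw [measure_biUnion_finset disj fun c _ => measurableSet_ball]
        simp only [μ.addHaar_ball_of_pos _ hδ2, Finset.sum_const, nsmul_eq_mul, mul_assoc]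
      _ ≤ μ (ball (0 : E) (1 + δ / 2)) := measure_mono hsub
      _ = _ := μ.addHaar_ball_of_pos _ hρ
  have hcard := ENNReal.toReal_le_of_le_ofReal (pow_nonneg hρ.le _)
    ((ENNReal.mul_le_mul_iff_left (measure_ball_pos _ _ zero_lt_one).ne'
      measure_ball_lt_top.ne).1 hvol)
  rw [ENNReal.toReal_mul, ENNReal.toReal_natCast, ENNReal.toReal_ofReal (by positivity),
    ← le_div_iff₀ (by positivity), ← div_pow] at hcard
  convert! hcard using 2
  field_simp
  ring

theorem exists_finset_net_unitBall {δ : ℝ} (hδ : 0 < δ) :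
    ∃ s : Finset E, (s.card : ℝ) ≤ (1 + 2 / δ) ^ finrank ℝ E ∧ (∀ c ∈ s, ‖c‖ ≤ 1) ∧
      ∀ x : E, ‖x‖ ≤ 1 → ∃ c ∈ s, ‖x - c‖ ≤ δ := by
  classical
  let P : Finset E → Prop := fun s =>
    (∀ c ∈ s, ‖c‖ ≤ 1) ∧ ∀ c ∈ s, ∀ d ∈ s, c ≠ d → δ ≤ ‖c - d‖
  have hbound : ∀ s, P s → (s.card : ℝ) ≤ (1 + 2 / δ) ^ finrank ℝ E :=
    fun s hs => card_le_of_separated_unitBall hδ s hs.1 hs.2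
  have hbdd : BddAbove (Finset.card '' {s | P s}) := by
    refine ⟨⌊(1 + 2 / δ) ^ finrank ℝ E⌋₊, ?_⟩
    rintro _ ⟨s, hs, rfl⟩
    exact Nat.le_floor (hbound s hs)
  obtain ⟨s, hs, hmax⟩ := Nat.sSup_mem (Set.Nonempty.image _ ⟨∅, by simp [P]⟩) hbdd
  refine ⟨s, hbound s hs, hs.1, fun x hx => ?_⟩
  by_contra! hfar
  have hxs : x ∉ s := fun hmem => by
    have := hfar x hmem
    simp only [sub_self, norm_zero] at this
    linarith
  have hP : P (insert x s) := by
    constructor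
    · simpa [hx] using hs.1
    · intro c hc d hd hcd
      rw [Finset.mem_insert] at hc hd
      rcases hc with rfl | hc <;> rcases hd with rfl | hd
      · exact absurd rfl hcd
      · exact (hfar d hd).le
      · rw [norm_sub_rev]
        exact (hfar c hc).le
      · exact hs.2 c hc d hd hcd
  have hle := le_csSup hbdd ⟨_, hP, rfl⟩
  rw [← hmax, Finset.card_insert_of_notMem hxs] at hle
  omega

end

theorem Submodule.exists_ge_finrank_eq {K V : Type*} [DivisionRing K] [AddCommGroup V]
    [Module K V] [FiniteDimensional K V] (W : Submodule K V) {r : ℕ} (hW : finrank K W ≤ r)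
    (hr : r ≤ finrank K V) : ∃ W' : Submodule K V, W ≤ W' ∧ finrank K W' = r := by
  induction r, hW using Nat.le_induction with
  | base => exact ⟨W, le_rfl, rfl⟩
  | succ n _ ih =>
    obtain ⟨W', hle, hn⟩ := ih (by omega)
    have : ∃ v, v ∉ W' := by
      by_contra! hv
      rw [(Submodule.eq_top_iff'.2 hv : W' = ⊤), finrank_top] at hn
      omega
    obtain ⟨v, hv⟩ := this
    refine ⟨W' ⊔ K ∙ v, hle.trans le_sup_left, ?_⟩
    rw [finrank_sup_span_singleton hv, hn]

open scoped Matrix.Norms.L2Operator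

theorem specNorm_eq_norm {m n : Type*} [Fintype m] [Fintype n] [DecidableEq n]
    (A : Matrix m n ℝ) : specNorm A = ‖A‖ := rfl

theorem Matrix.toEuclideanLin_mul {l m n : Type*} [Fintype m] [Fintype n] [DecidableEq m]
    [DecidableEq n] (A : Matrix l m ℝ) (B : Matrix m n ℝ) :
    toEuclideanLin (A * B) = toEuclideanLin A ∘ₗ toEuclideanLin B := by
  ext1 x
  exact congrArg (fun f => WithLp.toLp 2 (f x.ofLp)) (Matrix.toLin'_mul A B)

theorem Matrix.exists_eq_mul_of_rank_le {m n r : ℕ} (hr : r ≤ m) (M : Matrix (Fin m) (Fin n) ℝ)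
    (hM : M.rank ≤ r) : ∃ (A : Matrix (Fin m) (Fin r) ℝ) (B : Matrix (Fin r) (Fin n) ℝ),
      M = A * B ∧ ‖A‖ ≤ 1 ∧ ‖B‖ ≤ ‖M‖ := by
  set f := toEuclideanLin M with hf
  have hrank : finrank ℝ (LinearMap.range f) ≤ r := by
    rwa [hf, toEuclideanLin_eq_toLin_orthonormal, ← rank_eq_finrank_range_toLin]
  obtain ⟨W, hW, hWr⟩ := Submodule.exists_ge_finrank_eq _ hrank (by simpa using hr)
  let b : OrthonormalBasis (Fin r) ℝ W := (stdOrthonormalBasis ℝ W).reindex (finCongr hWr)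
  let g : EuclideanSpace ℝ (Fin r) →ₗ[ℝ] EuclideanSpace ℝ (Fin m) :=
    W.subtype ∘ₗ b.repr.symm.toLinearEquiv.toLinearMap
  let h : EuclideanSpace ℝ (Fin n) →ₗ[ℝ] EuclideanSpace ℝ (Fin r) :=
    b.repr.toLinearEquiv.toLinearMap ∘ₗ f.codRestrict W fun x => hW ⟨x, rfl⟩
  have hgh : g ∘ₗ h = f := by
    ext1 x
    simp [g, h]
  refine ⟨toEuclideanLin.symm g, toEuclideanLin.symm h, ?_, ?_, ?_⟩
  · apply toEuclideanLin.injective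
    rw [toEuclideanLin_mul, LinearEquiv.apply_symm_apply, LinearEquiv.apply_symm_apply, hgh]
  · rw [l2_opNorm_def, LinearEquiv.trans_apply, LinearEquiv.apply_symm_apply]
    refine ContinuousLinearMap.opNorm_le_bound _ zero_le_one fun x => ?_
    simp only [one_mul]
    exact (b.repr.symm.norm_map x).le
  · rw [l2_opNorm_def, LinearEquiv.trans_apply, LinearEquiv.apply_symm_apply]
    refine ContinuousLinearMap.opNorm_le_bound _ (norm_nonneg _) fun x => ?_
    exact (b.repr.norm_map _).trans_le (M.l2_opNorm_mulVec x)

theorem Matrix.exists_fin_net_l2_opNorm (m n : ℕ) {δ : ℝ} (hδ : 0 < δ) :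
    ∃ (N : ℕ) (U : Fin N → Matrix (Fin m) (Fin n) ℝ), (N : ℝ) ≤ (1 + 2 / δ) ^ (m * n) ∧
      (∀ j, ‖U j‖ ≤ 1) ∧ ∀ A, ‖A‖ ≤ 1 → ∃ j, ‖A - U j‖ ≤ δ := by
  obtain ⟨s, hcard, hs, hnet⟩ :=
    exists_finset_net_unitBall (E := Matrix (Fin m) (Fin n) ℝ) hδ
  refine ⟨s.card, fun j => s.equivFin.symm j, ?_, fun j => hs _ (s.equivFin.symm j).2,
    fun A hA => ?_⟩
  · simpa [finrank_matrix] using hcard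
  · obtain ⟨c, hc, hAc⟩ := hnet A hA
    exact ⟨s.equivFin ⟨c, hc⟩, by simpa using hAc⟩

theorem Matrix.l2_opNorm_transpose {m n : Type*} [Fintype m] [Fintype n] [DecidableEq m]
    [DecidableEq n] (A : Matrix m n ℝ) : ‖Aᵀ‖ = ‖A‖ := by
  rw [← conjTranspose_eq_transpose_of_trivial, l2_opNorm_conjTranspose]

/-- **Low-rank matrix ε-net.** Every `d × d'` matrix of spectral norm at most 1 and rank at
most `r` is within spectral distance `ε` of a product `U Vᵀ` of net elements, where the nets
of the factor balls have cardinality at most `(1 + 4/ε)^{dr}` and `(1 + 4/ε)^{d'r}`. -/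
theorem low_rank_matrix_net (d d' r : ℕ) (hd : 0 < d) (hd' : 0 < d') (hr : 0 < r)
    (hrd : r ≤ min d d') (ε : ℝ) (hε : 0 < ε) :
    ∃ (N N' : ℕ) (U : Fin N → Matrix (Fin d) (Fin r) ℝ)
      (V : Fin N' → Matrix (Fin d') (Fin r) ℝ),
      (N : ℝ) ≤ (1 + 4 / ε) ^ (d * r) ∧
      (N' : ℝ) ≤ (1 + 4 / ε) ^ (d' * r) ∧
      (∀ j, specNorm (U j) ≤ 1) ∧
      (∀ j', specNorm (V j') ≤ 1) ∧
      (∀ M : Matrix (Fin d) (Fin d') ℝ, specNorm M ≤ 1 → M.rank ≤ r →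
        ∃ j j', specNorm (M - U j * (V j')ᵀ) ≤ ε) := by
  simp only [specNorm_eq_norm]
  have hε2 : 0 < ε / 2 := by positivity
  have hconst : 2 / (ε / 2) = 4 / ε := by field_simp; norm_num
  obtain ⟨N, U, hN, hU, hUnet⟩ := exists_fin_net_l2_opNorm d r hε2
  obtain ⟨N', V, hN', hV, hVnet⟩ := exists_fin_net_l2_opNorm d' r hε2
  rw [hconst] at hN hN'
  refine ⟨N, N', U, V, hN, hN', hU, hV, fun M hM hrank => ?_⟩
  obtain ⟨A, B, rfl, hA, hB⟩ := exists_eq_mul_of_rank_le (hrd.trans (min_le_left _ _)) M hrank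
  obtain ⟨j, hj⟩ := hUnet A hA
  have hB1 : ‖B‖ ≤ 1 := hB.trans hM
  obtain ⟨j', hj'⟩ := hVnet Bᵀ (by rwa [l2_opNorm_transpose])
  refine ⟨j, j', ?_⟩
  have hBV : ‖B - (V j')ᵀ‖ ≤ ε / 2 := by
    rwa [← l2_opNorm_transpose, transpose_sub, transpose_transpose]
  calc ‖A * B - U j * (V j')ᵀ‖ = ‖(A - U j) * B + U j * (B - (V j')ᵀ)‖ := by
        rw [Matrix.sub_mul, Matrix.mul_sub, sub_add_sub_cancel]
    _ ≤ ‖A - U j‖ * ‖B‖ + ‖U j‖ * ‖B - (V j')ᵀ‖ :=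
        (norm_add_le _ _).trans (add_le_add (l2_opNorm_mul _ _) (l2_opNorm_mul _ _))
    _ ≤ ε / 2 * 1 + 1 * (ε / 2) := by gcongr; exact hU j
    _ = ε := by ring
end

section
/- Let d, d', r be positive integers with r < min(d, d'), let ε > 0, and let f be a linear map from ℝ^{d×d'} to a real normed vector space. If M and M̃ are matrices in ℝ^{d×d'} with ‖M‖_S ≤ 1, ‖M̃‖_S ≤ 1, rank(M) ≤ r, rank(M̃) ≤ r, and ‖M − M̃‖_S ≤ ε, then ‖f(M − M̃)‖ ≤ 2ε · sup{‖f(N)‖ : N ∈ ℝ^{d×d'}, ‖N‖_S ≤ 1, rank(N) ≤ r}. -/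
open Matrix

section SpectralNorm

open scoped Matrix.Norms.L2Operator

variable {m n : Type*} [Fintype m] [Fintype n] [DecidableEq n]

theorem specNorm_eq_l2_opNorm (A : Matrix m n ℝ) : specNorm A = ‖A‖ := rfl

/-- The matrix of the orthogonal projection onto the column space of `M`. -/
theorem exists_projection_onto_range [DecidableEq m] (M : Matrix m n ℝ) :
    ∃ P : Matrix m m ℝ, ‖P‖ ≤ 1 ∧ ‖1 - P‖ ≤ 1 ∧ P * M = M ∧ P.rank ≤ M.rank := by
  let U := LinearMap.range (toEuclideanLin M)
  let e := toEuclideanCLM (n := m) (𝕜 := ℝ)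
  have he : e (e.symm U.starProjection) = U.starProjection := e.apply_symm_apply _
  refine ⟨e.symm U.starProjection, ?_, ?_, ?_, ?_⟩
  · rw [cstar_norm_def]
    change ‖e (e.symm U.starProjection)‖ ≤ 1
    rw [he]
    exact U.starProjection_norm_le
  · rw [cstar_norm_def, map_sub, map_one]
    change ‖1 - e (e.symm U.starProjection)‖ ≤ 1
    rw [he, ← Submodule.starProjection_orthogonal']
    exact Uᗮ.starProjection_norm_le
  · apply toEuclideanLin.injective
    ext1 x
    have hx : e (e.symm U.starProjection) (toEuclideanLin M x) = toEuclideanLin M x := by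
      rw [he]
      exact Submodule.starProjection_eq_self_iff.mpr (LinearMap.mem_range_self _ x)
    rw [← hx]
    exact congrArg (WithLp.toLp 2) (mulVec_mulVec _ _ _).symm
  · rw [rank_eq_finrank_range_toLin _ (EuclideanSpace.basisFun m ℝ).toBasis
        (EuclideanSpace.basisFun m ℝ).toBasis,
      rank_eq_finrank_range_toLin M (EuclideanSpace.basisFun m ℝ).toBasis
        (EuclideanSpace.basisFun n ℝ).toBasis]
    apply Submodule.finrank_mono
    rintro _ ⟨x, rfl⟩
    change e (e.symm U.starProjection) x ∈ U
    rw [he]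
    exact U.starProjection_apply_mem x

/-- A difference of matrices of ranks at most `r` and `s` splits into summands of ranks at most
`r` and `s` whose spectral norms do not exceed that of the difference. -/
theorem exists_sub_eq_add_specNorm_le [DecidableEq m] (M N : Matrix m n ℝ) :
    ∃ A B : Matrix m n ℝ, M - N = A + B ∧ A.rank ≤ M.rank ∧ B.rank ≤ N.rank ∧
      specNorm A ≤ specNorm (M - N) ∧ specNorm B ≤ specNorm (M - N) := by
  obtain ⟨P, hP, hP', hPM, hrank⟩ := exists_projection_onto_range M
  have hB : (1 - P) * (M - N) = (P - 1) * N := by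
    simp only [Matrix.mul_sub, Matrix.sub_mul, hPM, Matrix.one_mul]
    abel
  simp only [specNorm_eq_l2_opNorm]
  refine ⟨P * (M - N), (1 - P) * (M - N), ?_, (rank_mul_le_left _ _).trans hrank,
    (congrArg rank hB).trans_le (rank_mul_le_right _ _), ?_, ?_⟩
  · rw [← Matrix.add_mul, add_sub_cancel, Matrix.one_mul]
  · exact (l2_opNorm_mul _ _).trans (mul_le_of_le_one_left (norm_nonneg _) hP)
  · exact (l2_opNorm_mul _ _).trans (mul_le_of_le_one_left (norm_nonneg _) hP')

theorem specNorm_smul (c : ℝ) (A : Matrix m n ℝ) : specNorm (c • A) = |c| * specNorm A := by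
  simp only [specNorm_eq_l2_opNorm, norm_smul, Real.norm_eq_abs]

theorem bddAbove_norm_image_specNorm_le_one {F : Type*} [NormedAddCommGroup F] [NormedSpace ℝ F]
    (f : Matrix m n ℝ →ₗ[ℝ] F) (r : ℕ) :
    BddAbove ((fun N => ‖f N‖) '' {N | specNorm N ≤ 1 ∧ N.rank ≤ r}) := by
  refine ⟨‖LinearMap.toContinuousLinearMap f‖, ?_⟩
  rintro _ ⟨N, ⟨hN, -⟩, rfl⟩
  exact (LinearMap.toContinuousLinearMap f).unit_le_opNorm N hN

theorem norm_le_mul_sSup_of_rank_le {F : Type*} [NormedAddCommGroup F] [NormedSpace ℝ F]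
    (f : Matrix m n ℝ →ₗ[ℝ] F) {r : ℕ} {ε : ℝ} (hε : 0 < ε) {A : Matrix m n ℝ}
    (hA : specNorm A ≤ ε) (hr : A.rank ≤ r) :
    ‖f A‖ ≤ ε * sSup ((fun N => ‖f N‖) '' {N | specNorm N ≤ 1 ∧ N.rank ≤ r}) := by
  have hrank : (ε⁻¹ • A).rank ≤ r := by
    rw [← Matrix.mul_one A, ← Matrix.mul_smul]
    exact (rank_mul_le_left _ _).trans hr
  have hnorm : specNorm (ε⁻¹ • A) ≤ 1 := by
    rw [specNorm_smul, abs_of_pos (inv_pos.mpr hε)]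
    exact inv_mul_le_one_of_le₀ hA hε.le
  calc ‖f A‖ = ε * ‖f (ε⁻¹ • A)‖ := by
        rw [map_smul, norm_smul, Real.norm_of_nonneg (inv_pos.mpr hε).le,
          mul_inv_cancel_left₀ hε.ne']
    _ ≤ _ := mul_le_mul_of_nonneg_left
        (le_csSup (bddAbove_norm_image_specNorm_le_one f r) ⟨_, ⟨hnorm, hrank⟩, rfl⟩) hε.le

end SpectralNorm

/-- **First inequality of display (lm-3-2).** If `M, M̃` are rank-`r` matrices in the spectral
unit ball with `‖M − M̃‖_S ≤ ε`, then for any linear map `f` into a normed space,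
`‖f (M − M̃)‖ ≤ 2ε · sup {‖f N‖ : ‖N‖_S ≤ 1, rank N ≤ r}`. -/
theorem low_rank_difference_bound {F : Type*} [NormedAddCommGroup F] [NormedSpace ℝ F]
    (d d' r : ℕ) (hd : 0 < d) (hd' : 0 < d') (hr : 0 < r) (hrd : r < min d d')
    (ε : ℝ) (hε : 0 < ε)
    (f : Matrix (Fin d) (Fin d') ℝ →ₗ[ℝ] F)
    (M Mt : Matrix (Fin d) (Fin d') ℝ)
    (hM : specNorm M ≤ 1) (hMt : specNorm Mt ≤ 1)
    (hMr : M.rank ≤ r) (hMtr : Mt.rank ≤ r)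
    (hdiff : specNorm (M - Mt) ≤ ε) :
    ‖f (M - Mt)‖ ≤ 2 * ε *
      sSup ((fun N : Matrix (Fin d) (Fin d') ℝ => ‖f N‖) ''
        {N | specNorm N ≤ 1 ∧ N.rank ≤ r}) := by
  obtain ⟨A, B, hAB, hAr, hBr, hA, hB⟩ := exists_sub_eq_add_specNorm_le M Mt
  have hfA := norm_le_mul_sSup_of_rank_le f hε (hA.trans hdiff) (hAr.trans hMr)
  have hfB := norm_le_mul_sSup_of_rank_le f hε (hB.trans hdiff) (hBr.trans hMtr)
  rw [hAB, map_add]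
  linarith [norm_add_le (f A) (f B)]
end

section
/- Let J be a positive integer and let d_k, d'_k, r_k (k = 1, …, J) be positive integers with r_k ≤ min(d_k, d'_k). For each k, let S_{U,k} be a nonempty finite subset of {U ∈ ℝ^{d_k×r_k} : ‖U‖_S ≤ 1} such that every matrix in that set-ball is within spectral-norm distance 1/(8J) of some element of S_{U,k}, and let S_{V,k} ⊆ {V ∈ ℝ^{d'_k×r_k} : ‖V‖_S ≤ 1} have the same (1/(8J))-net property. Then for every linear map f from the space of (∏_k d_k) × (∏_k d'_k) real matrices to a real normed vector space, the supremum of ‖f(⊗_{k=1}^J M_k)‖ over all families (M_k) with ‖M_k‖_S ≤ 1 and rank(M_k) ≤ r_k for every k is at most 2 · max ‖f(⊗_{k=1}^J (U_k V_kᵀ))‖, the maximum taken over all choices U_k ∈ S_{U,k}, V_k ∈ S_{V,k}. -/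
open Matrix

/-- The Kronecker product `⊗_{k} M_k` of a finite family of matrices, as a matrix indexed
by tuples, with entry at `((i₁,…,i_J),(j₁,…,j_J))` equal to `∏ k, (M_k)_{i_k, j_k}`. -/
def kronFamily {J : ℕ} {d d' : Fin J → ℕ}
    (M : ∀ k, Matrix (Fin (d k)) (Fin (d' k)) ℝ) :
    Matrix (∀ k, Fin (d k)) (∀ k, Fin (d' k)) ℝ :=
  Matrix.of fun i j => ∏ k, M k (i k) (j k)

open scoped Matrix.Norms.L2Operator

section Multilinear

variable {ι : Type*} [Fintype ι] {E : ι → Type*} [∀ i, NormedAddCommGroup (E i)]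
  [∀ i, NormedSpace ℝ (E i)] {F : Type*} [NormedAddCommGroup F] [NormedSpace ℝ F]

/-- A bound on the product of the closed unit balls bounds the operator norm. -/
theorem ContinuousMultilinearMap.opNorm_le_of_forall_unit (g : ContinuousMultilinearMap ℝ E F)
    {C : ℝ} (hC : 0 ≤ C) (h : ∀ m, (∀ i, ‖m i‖ ≤ 1) → ‖g m‖ ≤ C) : ‖g‖ ≤ C := by
  refine ContinuousMultilinearMap.opNorm_le_bound hC fun m => ?_
  by_cases hm : ∃ i, m i = 0
  · obtain ⟨i, hi⟩ := hm
    rw [g.map_coord_zero i hi, norm_zero]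
    positivity
  · push Not at hm
    have hpos : 0 < ∏ i, ‖m i‖ := Finset.prod_pos fun i _ => norm_pos_iff.2 (hm i)
    have key := h (fun i => ‖m i‖⁻¹ • m i) fun i => by
      rw [norm_smul, norm_inv, norm_norm, inv_mul_cancel₀ (norm_ne_zero_iff.2 (hm i))]
    rwa [g.map_smul_univ, norm_smul, Finset.prod_inv_distrib, norm_inv, Real.norm_of_nonneg hpos.le,
      inv_mul_le_iff₀ hpos, mul_comm] at key

/-- The operator norm of a multilinear map is controlled by its values on fine enough nets of the
unit balls. -/
theorem ContinuousMultilinearMap.opNorm_le_two_mul_of_net (g : ContinuousMultilinearMap ℝ E F)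
    (S : ∀ i, Set (E i)) {δ B : ℝ} (hδ : 0 ≤ δ) (hB : 0 ≤ B)
    (hcard : Fintype.card ι * δ ≤ 1 / 2) (hS : ∀ i, ∀ s ∈ S i, ‖s‖ ≤ 1)
    (hnet : ∀ i (x : E i), ‖x‖ ≤ 1 → ∃ s ∈ S i, ‖x - s‖ ≤ δ)
    (hg : ∀ s, (∀ i, s i ∈ S i) → ‖g s‖ ≤ B) : ‖g‖ ≤ 2 * B := by
  suffices h : ‖g‖ ≤ B + ‖g‖ / 2 by linarith
  refine g.opNorm_le_of_forall_unit (by positivity) fun m hm => ?_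
  choose s hsS hs using fun i => hnet i (m i) (hm i)
  have hmax : max ‖m‖ ‖s‖ ≤ 1 := max_le ((pi_norm_le_iff_of_nonneg zero_le_one).2 hm)
    ((pi_norm_le_iff_of_nonneg zero_le_one).2 fun i => hS i _ (hsS i))
  have hpow : max ‖m‖ ‖s‖ ^ (Fintype.card ι - 1) ≤ 1 :=
    pow_le_one₀ (le_max_of_le_left (norm_nonneg m)) hmax
  have hsub : ‖m - s‖ ≤ δ := (pi_norm_le_iff_of_nonneg hδ).2 hs
  calc ‖g m‖ ≤ ‖g s‖ + ‖g m - g s‖ := norm_le_norm_add_norm_sub' _ _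
    _ ≤ B + ‖g‖ * Fintype.card ι * max ‖m‖ ‖s‖ ^ (Fintype.card ι - 1) * ‖m - s‖ :=
      add_le_add (hg s hsS) (g.norm_image_sub_le m s)
    _ ≤ B + ‖g‖ * Fintype.card ι * 1 * δ := by gcongr
    _ = B + ‖g‖ * (Fintype.card ι * δ) := by ring
    _ ≤ B + ‖g‖ * (1 / 2) := by gcongr
    _ = B + ‖g‖ / 2 := by ring

end Multilinear

section Factorization

variable {m n : Type*} [Fintype m] [Fintype n] [DecidableEq n]

/-- The matrix whose columns are the vectors of an orthonormal basis of a subspace. -/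
noncomputable def OrthonormalBasis.columns {ι : Type*} [Fintype ι]
    {W : Submodule ℝ (EuclideanSpace ℝ m)}
    (b : OrthonormalBasis ι ℝ W) : Matrix m ι ℝ :=
  Matrix.of fun i j => (b j : EuclideanSpace ℝ m) i

theorem OrthonormalBasis.transpose_columns_mul_columns {ι : Type*} [Fintype ι] [DecidableEq ι]
    {W : Submodule ℝ (EuclideanSpace ℝ m)} (b : OrthonormalBasis ι ℝ W) :
    b.columnsᵀ * b.columns = 1 := by
  ext i j
  have := orthonormal_iff_ite.1 b.orthonormal i j
  rw [Submodule.coe_inner, PiLp.inner_apply] at this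
  simpa [Matrix.mul_apply, Matrix.one_apply, columns, mul_comm] using this

theorem OrthonormalBasis.columns_mul_transpose_mulVec {ι : Type*} [Fintype ι]
    {W : Submodule ℝ (EuclideanSpace ℝ m)} (b : OrthonormalBasis ι ℝ W)
    {x : EuclideanSpace ℝ m} (hx : x ∈ W) : (b.columns * b.columnsᵀ) *ᵥ x = x := by
  have hsum := congrArg W.subtype (b.sum_repr' ⟨x, hx⟩)
  rw [map_sum] at hsum
  ext i
  have hi := congrArg (fun y : EuclideanSpace ℝ m => y i) hsum
  simp only [map_smul, Submodule.subtype_apply, WithLp.ofLp_sum, Finset.sum_apply,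
    WithLp.ofLp_smul, Pi.smul_apply, smul_eq_mul, Submodule.coe_inner, PiLp.inner_apply] at hi
  rw [← Matrix.mulVec_mulVec, ← hi]
  simp only [mulVec, dotProduct, columns, of_apply, transpose_apply]
  refine Finset.sum_congr rfl fun j _ => ?_
  rw [mul_comm]
  simp [mul_comm]

/-- A real matrix of rank at most `r` is fixed by `U * Uᵀ` for a contraction `U` with `r`
columns. -/
theorem Matrix.exists_contraction_mul_transpose_mul_self [DecidableEq m] (M : Matrix m n ℝ) {r : ℕ}
    (hr : M.rank ≤ r) : ∃ U : Matrix m (Fin r) ℝ, ‖U‖ ≤ 1 ∧ U * Uᵀ * M = M := by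
  have hW : Module.finrank ℝ (LinearMap.range (toEuclideanLin M)) ≤ r := by
    rw [toEuclideanLin_eq_toLin_orthonormal]
    exact (M.rank_eq_finrank_range_toLin _ _).symm.trans_le hr
  generalize hWdef : LinearMap.range (toEuclideanLin M) = W at hW
  let B := (stdOrthonormalBasis ℝ W).columns
  have hBB : Bᵀ * B = 1 := (stdOrthonormalBasis ℝ W).transpose_columns_mul_columns
  have hBM : B * Bᵀ * M = M := by
    refine Matrix.ext_of_mulVec_single fun j => ?_
    rw [← Matrix.mulVec_mulVec]
    exact (stdOrthonormalBasis ℝ W).columns_mul_transpose_mulVec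
      (x := toEuclideanLin M (EuclideanSpace.single j 1)) (hWdef ▸ LinearMap.mem_range_self _ _)
  let P : Matrix (Fin (Module.finrank ℝ W)) (Fin r) ℝ :=
    (1 : Matrix (Fin r) (Fin r) ℝ).submatrix (Fin.castLE hW) id
  have hPP : P * Pᵀ = 1 := by
    ext i j
    simp [P, Matrix.mul_apply, Matrix.one_apply]
  have hUU : (B * P) * (B * P)ᵀ = B * Bᵀ := by
    rw [transpose_mul, Matrix.mul_assoc, ← Matrix.mul_assoc P, hPP, Matrix.one_mul]
  refine ⟨B * P, ?_, by rw [hUU, hBM]⟩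
  have hone : ‖(1 : Matrix (Fin (Module.finrank ℝ W)) (Fin (Module.finrank ℝ W)) ℝ)‖ ≤ 1 := by
    rw [← diagonal_one, l2_opNorm_diagonal]
    exact (pi_norm_le_iff_of_nonneg zero_le_one).2 fun _ => by simp
  have hBnorm : ‖B‖ ≤ 1 := by
    have h := l2_opNorm_conjTranspose_mul_self B
    rw [conjTranspose_eq_transpose_of_trivial, hBB] at h
    exact abs_le_one_iff_mul_self_le_one.2 (h ▸ hone) |> le_of_abs_le
  have hPnorm : ‖P‖ ≤ 1 := by
    have h := l2_opNorm_conjTranspose_mul_self Pᵀ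
    rw [conjTranspose_eq_transpose_of_trivial, transpose_transpose, hPP,
      ← conjTranspose_eq_transpose_of_trivial, l2_opNorm_conjTranspose] at h
    exact abs_le_one_iff_mul_self_le_one.2 (h ▸ hone) |> le_of_abs_le
  exact (l2_opNorm_mul _ _).trans (mul_le_one₀ hBnorm (norm_nonneg _) hPnorm)

/-- A contraction of rank at most `r` factors through dimension `r` as a product of
contractions. -/
theorem Matrix.exists_contraction_factorization [DecidableEq m] (M : Matrix m n ℝ) (hM : ‖M‖ ≤ 1) {r : ℕ}
    (hr : M.rank ≤ r) : ∃ (U : Matrix m (Fin r) ℝ) (V : Matrix n (Fin r) ℝ),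
      ‖U‖ ≤ 1 ∧ ‖V‖ ≤ 1 ∧ U * Vᵀ = M := by
  obtain ⟨U, hU, hUM⟩ := M.exists_contraction_mul_transpose_mul_self hr
  refine ⟨U, Mᵀ * U, hU, ?_, by rw [transpose_mul, transpose_transpose, ← Matrix.mul_assoc, hUM]⟩
  have hMt : ‖Mᵀ‖ ≤ 1 := by
    rwa [← conjTranspose_eq_transpose_of_trivial, l2_opNorm_conjTranspose]
  exact (l2_opNorm_mul _ _).trans (mul_le_one₀ hMt (norm_nonneg _) hU)

end Factorization

section Kronecker

variable {J : ℕ} {d d' : Fin J → ℕ}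

/-- The Kronecker product of a family of matrices as a multilinear map. -/
def kronMultilinear : MultilinearMap ℝ (fun k => Matrix (Fin (d k)) (Fin (d' k)) ℝ)
    (Matrix (∀ k, Fin (d k)) (∀ k, Fin (d' k)) ℝ) :=
  MultilinearMap.pi fun i => MultilinearMap.pi fun j =>
    (MultilinearMap.mkPiAlgebra ℝ (Fin J) ℝ).compLinearMap
      fun k => Matrix.entryLinearMap ℝ ℝ (i k) (j k)

theorem kronMultilinear_apply (M : ∀ k, Matrix (Fin (d k)) (Fin (d' k)) ℝ) :
    kronMultilinear M = kronFamily M := by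
  ext i j
  change MultilinearMap.mkPiAlgebra ℝ (Fin J) ℝ (fun k => M k (i k) (j k)) = _
  simp [kronFamily]

/-- The factors `U k`, `V k` collected in one family indexed by a sum type. -/
abbrev FactorSpace (d d' r : Fin J → ℕ) (i : Fin J ⊕ Fin J) : Type :=
  Matrix (Fin (Sum.elim d d' i)) (Fin (Sum.elim r r i)) ℝ

/-- The family of products `U k * (V k)ᵀ`. -/
def factorProd {r : Fin J → ℕ} (w : ∀ i, FactorSpace d d' r i) (k : Fin J) :
    Matrix (Fin (d k)) (Fin (d' k)) ℝ :=
  let U : Matrix (Fin (d k)) (Fin (r k)) ℝ := w (Sum.inl k)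
  let V : Matrix (Fin (d' k)) (Fin (r k)) ℝ := w (Sum.inr k)
  U * Vᵀ

theorem factorProd_congr {r : Fin J → ℕ} {w : ∀ i, FactorSpace d d' r i} {k : Fin J}
    {U : Matrix (Fin (d k)) (Fin (r k)) ℝ} {V : Matrix (Fin (d' k)) (Fin (r k)) ℝ}
    (hU : w (Sum.inl k) = U) (hV : w (Sum.inr k) = V) : factorProd w k = U * Vᵀ := by
  subst hU hV
  rfl

theorem factorProd_update_inl [DecidableEq (Fin J ⊕ Fin J)] {r : Fin J → ℕ}
    (w : ∀ i, FactorSpace d d' r i) (k : Fin J) (x : Matrix (Fin (d k)) (Fin (r k)) ℝ) :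
    factorProd (Function.update w (Sum.inl k) x) = Function.update (factorProd w) k
      (x * (show Matrix (Fin (d' k)) (Fin (r k)) ℝ from w (Sum.inr k))ᵀ) := by
  ext1 l
  obtain rfl | h := eq_or_ne l k
  · rw [Function.update_self]
    exact factorProd_congr (Function.update_self _ _ _) (Function.update_of_ne (by simp) _ _)
  · rw [Function.update_of_ne h]
    exact factorProd_congr (Function.update_of_ne (by simpa using h) _ _)
      (Function.update_of_ne (by simp) _ _)

theorem factorProd_update_inr [DecidableEq (Fin J ⊕ Fin J)] {r : Fin J → ℕ}
    (w : ∀ i, FactorSpace d d' r i) (k : Fin J) (x : Matrix (Fin (d' k)) (Fin (r k)) ℝ) :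
    factorProd (Function.update w (Sum.inr k) x) = Function.update (factorProd w) k
      ((show Matrix (Fin (d k)) (Fin (r k)) ℝ from w (Sum.inl k)) * xᵀ) := by
  ext1 l
  obtain rfl | h := eq_or_ne l k
  · rw [Function.update_self]
    exact factorProd_congr (Function.update_of_ne (by simp) _ _) (Function.update_self _ _ _)
  · rw [Function.update_of_ne h]
    exact factorProd_congr (Function.update_of_ne (by simp) _ _)
      (Function.update_of_ne (by simpa using h) _ _)

theorem continuous_kronFamily_factorProd {r : Fin J → ℕ} :
    Continuous fun w : ∀ i, FactorSpace d d' r i => kronFamily (factorProd w) := by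
  refine continuous_matrix fun i j => ?_
  simp only [kronFamily, of_apply]
  refine continuous_finsetProd _ fun k _ => ?_
  have hU : Continuous fun w : ∀ i, FactorSpace d d' r i => w (Sum.inl k) := continuous_apply _
  have hV : Continuous fun w : ∀ i, FactorSpace d d' r i => w (Sum.inr k) := continuous_apply _
  exact (Continuous.matrix_mul hU hV.matrix_transpose).matrix_elem _ _

/-- The multilinear map sending the factors `U k`, `V k` to `f (⨂ k, U k * (V k)ᵀ)`. -/
def kronFactorMultilinear {F : Type*} [NormedAddCommGroup F] [NormedSpace ℝ F] (r : Fin J → ℕ)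
    (f : Matrix (∀ k, Fin (d k)) (∀ k, Fin (d' k)) ℝ →ₗ[ℝ] F) :
    ContinuousMultilinearMap ℝ (FactorSpace d d' r) F where
  toFun w := f (kronFamily (factorProd w))
  map_update_add' {inst} w i x y := by
    simp only [← kronMultilinear_apply]
    rcases i with k | k
    · erw [factorProd_update_inl, factorProd_update_inl, factorProd_update_inl, Matrix.add_mul,
        MultilinearMap.map_update_add, map_add]
      rfl
    · erw [factorProd_update_inr, factorProd_update_inr, factorProd_update_inr,
        Matrix.transpose_add, Matrix.mul_add, MultilinearMap.map_update_add, map_add]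
  map_update_smul' {inst} w i c x := by
    simp only [← kronMultilinear_apply]
    rcases i with k | k
    · erw [factorProd_update_inl, factorProd_update_inl, Matrix.smul_mul,
        MultilinearMap.map_update_smul, map_smul]
      rfl
    · erw [factorProd_update_inr, factorProd_update_inr, Matrix.transpose_smul, Matrix.mul_smul,
        MultilinearMap.map_update_smul, map_smul]
  cont := f.continuous_of_finiteDimensional.comp continuous_kronFamily_factorProd

end Kronecker

/-- **Inequality (lm-3-4) of Lemma (iii).** Given `(1/(8J))`-nets of the factor spectral unit
balls, for any linear map `f` on `(∏_k d_k) × (∏_k d'_k)` matrices, the supremum of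
`‖f (⊗_k M_k)‖` over families of rank-constrained matrices in the spectral unit balls is at
most `2 · max ‖f (⊗_k U_k V_kᵀ)‖`, the maximum over all choices of net elements. -/
theorem kron_rank_constrained_subtraction {F : Type*} [NormedAddCommGroup F]
    [NormedSpace ℝ F] {J : ℕ} (hJ : 0 < J) (d d' r : Fin J → ℕ)
    (hd : ∀ k, 0 < d k) (hd' : ∀ k, 0 < d' k) (hr : ∀ k, 0 < r k)
    (hrd : ∀ k, r k ≤ min (d k) (d' k))
    (S_U : ∀ k, Finset (Matrix (Fin (d k)) (Fin (r k)) ℝ))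
    (S_V : ∀ k, Finset (Matrix (Fin (d' k)) (Fin (r k)) ℝ))
    (hSU : ∀ k, (S_U k).Nonempty) (hSV : ∀ k, (S_V k).Nonempty)
    (hUball : ∀ k, ∀ U ∈ S_U k, specNorm U ≤ 1)
    (hVball : ∀ k, ∀ V ∈ S_V k, specNorm V ≤ 1)
    (hUnet : ∀ k, ∀ U : Matrix (Fin (d k)) (Fin (r k)) ℝ, specNorm U ≤ 1 →
      ∃ u ∈ S_U k, specNorm (U - u) ≤ 1 / (8 * J))
    (hVnet : ∀ k, ∀ V : Matrix (Fin (d' k)) (Fin (r k)) ℝ, specNorm V ≤ 1 →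
      ∃ v ∈ S_V k, specNorm (V - v) ≤ 1 / (8 * J))
    (f : Matrix (∀ k, Fin (d k)) (∀ k, Fin (d' k)) ℝ →ₗ[ℝ] F) :
    ∀ M : ∀ k, Matrix (Fin (d k)) (Fin (d' k)) ℝ,
      (∀ k, specNorm (M k) ≤ 1) → (∀ k, (M k).rank ≤ r k) →
      ‖f (kronFamily M)‖ ≤
        2 * (Fintype.piFinset S_U).sup' (Fintype.piFinset_nonempty.mpr hSU)
          (fun u => (Fintype.piFinset S_V).sup' (Fintype.piFinset_nonempty.mpr hSV)
            (fun v => ‖f (kronFamily (fun k => u k * (v k)ᵀ))‖)) := by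
  intro M hM hMr
  set G : (∀ k, Matrix (Fin (d k)) (Fin (r k)) ℝ) →
      (∀ k, Matrix (Fin (d' k)) (Fin (r k)) ℝ) → ℝ :=
    fun u v => ‖f (kronFamily fun k => u k * (v k)ᵀ)‖
  change _ ≤ 2 * (Fintype.piFinset S_U).sup' (Fintype.piFinset_nonempty.mpr hSU)
    (fun u => (Fintype.piFinset S_V).sup' (Fintype.piFinset_nonempty.mpr hSV) (G u))
  set B := (Fintype.piFinset S_U).sup' (Fintype.piFinset_nonempty.mpr hSU)
    (fun u => (Fintype.piFinset S_V).sup' (Fintype.piFinset_nonempty.mpr hSV) (G u))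
  have hB : ∀ u v, (∀ k, u k ∈ S_U k) → (∀ k, v k ∈ S_V k) → G u v ≤ B := fun u v hu hv =>
    (Finset.le_sup' (G u) (Fintype.mem_piFinset.2 hv)).trans
      (Finset.le_sup' (fun u => (Fintype.piFinset S_V).sup' (Fintype.piFinset_nonempty.mpr hSV)
        (G u)) (Fintype.mem_piFinset.2 hu))
  clear_value B
  have hB0 : 0 ≤ B := by
    choose u hu using hSU
    choose v hv using hSV
    exact (norm_nonneg _).trans (hB u v hu hv)
  have hcard : (Fintype.card (Fin J ⊕ Fin J) : ℝ) * (1 / (8 * J)) ≤ 1 / 2 := by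
    have : (J : ℝ) ≠ 0 := by positivity
    simp only [Fintype.card_sum, Fintype.card_fin, Nat.cast_add]
    field_simp
    norm_num
  let S : ∀ i, Set (FactorSpace d d' r i) :=
    Sum.rec (fun k => (S_U k : Set (Matrix (Fin (d k)) (Fin (r k)) ℝ)))
      (fun k => (S_V k : Set (Matrix (Fin (d' k)) (Fin (r k)) ℝ)))
  have hg : ‖kronFactorMultilinear r f‖ ≤ 2 * B := by
    refine (kronFactorMultilinear r f).opNorm_le_two_mul_of_net S (δ := 1 / (8 * J))
      (by positivity) hB0 hcard ?_ ?_ ?_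
    · rintro (k | k)
      exacts [hUball k, hVball k]
    · rintro (k | k)
      exacts [hUnet k, hVnet k]
    · exact fun s hs => hB (fun k => s (Sum.inl k)) (fun k => s (Sum.inr k))
        (fun k => hs (Sum.inl k)) (fun k => hs (Sum.inr k))
  choose U V hU hV hUV using fun k => (M k).exists_contraction_factorization (hM k) (hMr k)
  let w : ∀ i, FactorSpace d d' r i := Sum.rec U V
  have hw : kronFactorMultilinear r f w = f (kronFamily M) :=
    congrArg (fun N => f (kronFamily N)) (funext hUV)
  rw [← hw]
  refine ((kronFactorMultilinear r f).le_opNorm w).trans ?_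
  refine (mul_le_of_le_one_right (norm_nonneg _) ?_).trans hg
  refine Finset.prod_le_one (fun _ _ => norm_nonneg _) ?_
  rintro (k | k) -
  exacts [hU k, hV k]
end
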